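/- arXiv:1810.10067 — 4 statements merged into one kernel-verified Lean document; each statement's English description precedes it below -/
import Mathlib

section
/- Let A, C, D ∈ B(H), and let f, g be nonnegative continuous functions on [0,∞) satisfying f(t)g(t) = t for all t ≥ 0. Then for all vectors u, v ∈ H, |⟨ADu, Cv⟩|² ≤ ⟨D* f(|A|)² D u, u⟩ · ⟨C* g(|A*|)² C v, v⟩. -/
open scoped InnerProductSpace
open ContinuousLinearMap

/-- The absolute value `|A| = (A^*A)^{1/2}` of a bounded operator, via the
continuous functional calculus. -/
noncomputable def oabs {H : Type*} [NormedAddCommGroup H] [InnerProductSpace ℂ H]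
    [CompleteSpace H] (A : H →L[ℂ] H) : H →L[ℂ] H :=
  cfc Real.sqrt (adjoint A * A)

section helpers
variable {H : Type*} [NormedAddCommGroup H] [InnerProductSpace ℂ H] [CompleteSpace H]

lemma aux_poly (A a b : H →L[ℂ] H) (hab : A * a = b * A) (p : Polynomial ℝ) :
    A * Polynomial.aeval a p = Polynomial.aeval b p * A := by
  have hp : ∀ n : ℕ, A * a ^ n = b ^ n * A := fun n =>
    (SemiconjBy.pow_right (show SemiconjBy A a b from hab) n)
  induction p using Polynomial.induction_on' with
  | add p q hp hq => simp only [map_add, mul_add, add_mul, hp, hq]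
  | monomial n r =>
    simp only [Polynomial.aeval_monomial]
    rw [mul_assoc, ← hp n, ← mul_assoc, ← mul_assoc, Algebra.commutes]

lemma aux_int (A a b : H →L[ℂ] H) (hab : A * a = b * A) (ha : IsSelfAdjoint a)
    (hb : IsSelfAdjoint b) (h : ℝ → ℝ) (hh : Continuous h) :
    A * cfc h a = cfc h b * A := by
  rw [← sub_eq_zero, ← norm_le_zero_iff]
  refine le_of_forall_pos_le_add fun ε hε => ?_
  set δ := ε / (2 * ‖A‖ + 1) with hδ
  have hδ0 : 0 < δ := by positivity
  set R := max (‖a‖ * ‖(1 : H →L[ℂ] H)‖) (‖b‖ * ‖(1 : H →L[ℂ] H)‖) with hR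
  obtain ⟨p, hp⟩ := exists_polynomial_near_of_continuousOn (-R) R h hh.continuousOn δ hδ0
  have key : ∀ c : H →L[ℂ] H, IsSelfAdjoint c → ‖c‖ * ‖(1 : H →L[ℂ] H)‖ ≤ R →
      ‖Polynomial.aeval c p - cfc h c‖ ≤ δ := by
    intro c hc hcR
    rw [← cfc_polynomial p c hc, ← cfc_sub p.eval h c p.continuous.continuousOn hh.continuousOn]
    refine norm_cfc_le hδ0.le fun x hx => ?_
    have := (spectrum.norm_le_norm_mul_of_mem hx).trans hcR
    exact (hp x (abs_le.mp this)).le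
  have h1 := key a ha (le_max_left _ _)
  have h2 := key b hb (le_max_right _ _)
  have e : A * cfc h a - cfc h b * A = (Polynomial.aeval b p - cfc h b) * A
      - A * (Polynomial.aeval a p - cfc h a) := by
    rw [sub_mul, mul_sub, aux_poly A a b hab p]; abel
  rw [e]
  calc _ ≤ ‖(Polynomial.aeval b p - cfc h b) * A‖ + ‖A * (Polynomial.aeval a p - cfc h a)‖ :=
        norm_sub_le _ _
    _ ≤ δ * ‖A‖ + ‖A‖ * δ := by
        refine add_le_add ((norm_mul_le _ _).trans ?_) ((norm_mul_le _ _).trans ?_) <;> gcongr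
    _ ≤ δ * (2 * ‖A‖ + 1) := by nlinarith
    _ = 0 + ε := by rw [hδ]; field_simp; ring

lemma aux_spec (A : H →L[ℂ] H) (s : ℝ) (hs : s ∈ spectrum ℝ (adjoint A * A)) : 0 ≤ s :=
  spectrum_nonneg_of_nonneg (star_mul_self_nonneg A) hs

lemma aux_nrm (A : H →L[ℂ] H) (h : ℝ → ℝ) (hh : Continuous h) (c : ℝ) (hc : 0 ≤ c)
    (hb : ∀ s, 0 ≤ s → s * h s ^ 2 ≤ c ^ 2) : ‖A * cfc h (adjoint A * A)‖ ≤ c := by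
  have hS : IsSelfAdjoint (adjoint A * A) := IsSelfAdjoint.star_mul_self A
  have hsa : IsSelfAdjoint (cfc h (adjoint A * A)) := cfc_predicate h _
  refine abs_le_of_sq_le_sq' ?_ hc |>.2
  rw [sq, ← CStarRing.norm_star_mul_self, star_mul, hsa.star_eq]
  have e : cfc h (adjoint A * A) * star A * (A * cfc h (adjoint A * A)) =
      cfc (fun s => h s * s * h s) (adjoint A * A) := by
    rw [cfc_mul (fun s => h s * s) h _ (by fun_prop) (by fun_prop),
      cfc_mul h (fun s => s) _ (by fun_prop) (by fun_prop), cfc_id' ℝ (adjoint A * A) hS]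
    simp only [mul_assoc]
    rfl
  rw [e]
  refine norm_cfc_le (by positivity) fun s hs => ?_
  have hs0 := aux_spec A s hs
  have := hb s hs0
  rw [Real.norm_eq_abs, abs_of_nonneg (by nlinarith [mul_nonneg hs0 (sq_nonneg (h s))])]
  linarith

lemma aux_main (A : H →L[ℂ] H) (F G : ℝ → ℝ) (hF : Continuous F) (hG : Continuous G)
    (hFG : ∀ s, 0 ≤ s → F s * G s = Real.sqrt s) (x y : H) :
    ‖⟪A x, y⟫_ℂ‖ ≤ ‖cfc F (adjoint A * A) x‖ * ‖cfc G (A * adjoint A) y‖ := by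
  have hS : IsSelfAdjoint (adjoint A * A) := IsSelfAdjoint.star_mul_self A
  have hT : IsSelfAdjoint (A * adjoint A) := IsSelfAdjoint.mul_star_self A
  have hGT : IsSelfAdjoint (cfc G (A * adjoint A)) := cfc_predicate G _
  refine le_of_forall_pos_le_add fun ε hε => ?_
  set δ := ε / (‖x‖ * ‖y‖ + 1) with hδ
  have hδ0 : 0 < δ := by positivity
  have hne : ∀ s : ℝ, |s| + δ ^ 2 ≠ 0 := fun s => by positivity
  set m : ℝ → ℝ := fun s => Real.sqrt s / (|s| + δ ^ 2) with hm
  set l : ℝ → ℝ := fun s => δ ^ 2 / (|s| + δ ^ 2) with hl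
  have hmc : Continuous m := Real.continuous_sqrt.div (by fun_prop) hne
  have hlc : Continuous l := continuous_const.div (by fun_prop) hne
  have n1 : ‖A * cfc m (adjoint A * A)‖ ≤ 1 := by
    refine aux_nrm A m hmc 1 zero_le_one fun s hs => ?_
    simp only [hm]
    rw [div_pow, Real.sq_sqrt hs, abs_of_nonneg hs, ← mul_div_assoc, div_le_iff₀ (by positivity)]
    nlinarith [mul_nonneg hs (sq_nonneg δ), sq_nonneg (δ ^ 2)]
  have n2 : ‖A * cfc l (adjoint A * A)‖ ≤ δ := by
    refine aux_nrm A l hlc δ hδ0.le fun s hs => ?_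
    simp only [hl]
    rw [div_pow, abs_of_nonneg hs, ← mul_div_assoc, div_le_iff₀ (by positivity)]
    have : 0 ≤ δ ^ 2 * (s ^ 2 + s * δ ^ 2 + (δ ^ 2) ^ 2) := by positivity
    nlinarith
  have hA : A = cfc G (A * adjoint A) * (A * cfc m (adjoint A * A)) * cfc F (adjoint A * A)
      + A * cfc l (adjoint A * A) := by
    rw [← mul_assoc, ← aux_int A (adjoint A * A) (A * adjoint A) (mul_assoc _ _ _).symm hS hT G hG,
      mul_assoc, mul_assoc, ← mul_add,
      ← cfc_mul m F _ hmc.continuousOn hF.continuousOn,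
      ← cfc_mul G (fun x => m x * F x) _ hG.continuousOn (hmc.mul hF).continuousOn,
      ← cfc_add (a := adjoint A * A) (fun x => G x * (m x * F x)) l (hG.mul (hmc.mul hF)).continuousOn hlc.continuousOn]
    have : cfc (fun s => G s * (m s * F s) + l s) (adjoint A * A) =
        cfc (fun _ => (1 : ℝ)) (adjoint A * A) := by
      refine cfc_congr fun s hs => ?_
      have hs0 := aux_spec A s hs
      have h1 : G s * (m s * F s) = (F s * G s) * m s := by ring
      have h2 : Real.sqrt s * Real.sqrt s = s := Real.mul_self_sqrt hs0
      change G s * (m s * F s) + l s = 1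
      rw [h1, hFG s hs0]
      simp only [hm, hl]
      have := hne s
      rw [abs_of_nonneg hs0] at this ⊢
      rw [← mul_div_assoc, h2, ← add_div, div_self this]
    rw [this, cfc_const_one ℝ (adjoint A * A) hS, mul_one]
  have hAx : ⟪A x, y⟫_ℂ = ⟪(A * cfc m (adjoint A * A)) (cfc F (adjoint A * A) x),
      cfc G (A * adjoint A) y⟫_ℂ + ⟪(A * cfc l (adjoint A * A)) x, y⟫_ℂ := by
    conv_lhs => rw [hA]
    rw [add_apply, inner_add_left]
    congr 1
    exact hGT.isSymmetric _ _
  rw [hAx]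
  refine (norm_add_le _ _).trans (add_le_add ?_ ?_)
  · refine (norm_inner_le_norm _ _).trans ?_
    gcongr
    simpa using le_of_opNorm_le _ n1 (cfc F (adjoint A * A) x)
  · calc _ ≤ ‖(A * cfc l (adjoint A * A)) x‖ * ‖y‖ := norm_inner_le_norm _ _
      _ ≤ δ * ‖x‖ * ‖y‖ := by gcongr; exact le_of_opNorm_le _ n2 x
      _ ≤ δ * (‖x‖ * ‖y‖ + 1) := by nlinarith
      _ = ε := by rw [hδ]; field_simp

lemma aux_sq (B D : H →L[ℂ] H) (hB : IsSelfAdjoint B) (u : H) :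
    (⟪(adjoint D * B ^ 2 * D) u, u⟫_ℂ).re = ‖B (D u)‖ ^ 2 := by
  have : ⟪(adjoint D * B ^ 2 * D) u, u⟫_ℂ = ⟪B (D u), B (D u)⟫_ℂ := by
    rw [sq]
    change ⟪adjoint D (B (B (D u))), u⟫_ℂ = _
    rw [adjoint_inner_left]
    exact hB.isSymmetric _ _
  rw [this]
  exact (norm_sq_eq_re_inner (𝕜 := ℂ) _).symm

lemma aux_comp (A : H →L[ℂ] H) (f : ℝ → ℝ) (hf : Continuous f) :
    cfc f (oabs A) = cfc (fun s => f (Real.sqrt s)) (adjoint A * A) := by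
  have hS : IsSelfAdjoint (adjoint A * A) := IsSelfAdjoint.star_mul_self A
  exact (cfc_comp' f Real.sqrt (adjoint A * A) hf.continuousOn
    Real.continuous_sqrt.continuousOn hS).symm

end helpers

theorem stmt1 {H : Type*} [NormedAddCommGroup H] [InnerProductSpace ℂ H] [CompleteSpace H]
    (A C D : H →L[ℂ] H) (f g : ℝ → ℝ) (hf : Continuous f) (hg : Continuous g)
    (hf0 : ∀ t : ℝ, 0 ≤ t → 0 ≤ f t) (hg0 : ∀ t : ℝ, 0 ≤ t → 0 ≤ g t)
    (hfg : ∀ t : ℝ, 0 ≤ t → f t * g t = t)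
    (u v : H) :
    ‖⟪(A * D) u, C v⟫_ℂ‖ ^ 2 ≤
      (⟪(adjoint D * (cfc f (oabs A)) ^ 2 * D) u, u⟫_ℂ).re *
        (⟪(adjoint C * (cfc g (oabs (adjoint A))) ^ 2 * C) v, v⟫_ℂ).re := by
  rw [aux_sq _ _ (cfc_predicate f _), aux_sq _ _ (cfc_predicate g _), aux_comp A f hf,
    aux_comp _ g hg, adjoint_adjoint, ← mul_pow]
  exact pow_le_pow_left₀ (norm_nonneg _) (aux_main A _ _ (hf.comp Real.continuous_sqrt)
    (hg.comp Real.continuous_sqrt) (fun s _ => hfg _ (Real.sqrt_nonneg s)) (D u) (C v)) 2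
end

section
/- Let A₁,…,A_n, B₁,…,B_n, C₁,…,C_n ∈ B(H) be such that |A_i|B_i = B_i*|A_i| and |A_i*|C_i = C_i*|A_i*| for each i = 1,…,n, and let f, g be nonnegative continuous functions on [0,∞) satisfying f(t)g(t) = t for all t ≥ 0. Then for all p, q > 1 with 1/p + 1/q = 1: ‖Σ_{i=1}^n C_i* A_i B_i‖ ≤ max_{1≤i≤n}{r(B_i)r(C_i)} · (Σ_{i=1}^n ‖f(|A_i|)‖^p)^{1/p} · (Σ_{i=1}^n ‖g(|A_i*|)‖^q)^{1/q}. -/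
open scoped InnerProductSpace
open ContinuousLinearMap

theorem aux_intertwine {R : Type*} [CStarAlgebra R] [PartialOrder R] [StarOrderedRing R]
    {a X Y : R} (hX : 0 ≤ X) (hY : 0 ≤ Y) (h : a * (X * X) = Y * Y * a) : a * X = Y * a := by
  have sX : star X = X := (IsSelfAdjoint.of_nonneg hX).star_eq
  have sY : star Y = Y := (IsSelfAdjoint.of_nonneg hY).star_eq
  obtain ⟨D, hD⟩ : ∃ D, D = a * X - Y * a := ⟨_, rfl⟩
  have h1 : Y * D = -(D * X) := by
    rw [hD, mul_sub, sub_mul, mul_assoc a, h]; noncomm_ring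
  have h2 : 0 ≤ star D * (Y * D) := by
    have := star_left_conjugate_nonneg hY D
    rwa [mul_assoc] at this
  have h3 : star D * (Y * D) = -(star D * D * X) := by rw [h1]; noncomm_ring
  have hsa : star (star D * D * X) = star D * D * X := by
    have := (IsSelfAdjoint.of_nonneg h2).star_eq
    rw [h3, star_neg] at this
    exact neg_injective this
  have hc : Commute (star D * D) X := by
    rw [star_mul, star_mul, star_star, sX] at hsa
    exact hsa.symm
  have h4 : 0 ≤ star D * D * X := hc.mul_nonneg (star_mul_self_nonneg D) hX
  have h5 : star D * D * X = 0 := by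
    apply le_antisymm _ h4
    rw [h3] at h2
    exact neg_nonneg.mp h2
  have h6 : D * X = 0 := by
    rw [← CStarRing.star_mul_self_eq_zero_iff, star_mul, mul_assoc, ← mul_assoc (star D), h5, mul_zero]
  have h7 : Y * D = 0 := by rw [h1, h6, neg_zero]
  have h8 : star D * D = X * star a * D := by
    have : star D = X * star a - star a * Y := by
      rw [hD, star_sub, star_mul, star_mul, sX, sY]
    rw [this, sub_mul, mul_assoc (star a), h7, mul_zero, sub_zero]
  have h9 : D * (star D * D) = 0 := by
    rw [h8, ← mul_assoc, ← mul_assoc, h6, zero_mul, zero_mul]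
  have h10 : star D * D = 0 := by
    rw [← CStarRing.star_mul_self_eq_zero_iff, star_mul, star_star, mul_assoc, h9, mul_zero]
  have h11 : D = 0 := (CStarRing.star_mul_self_eq_zero_iff D).mp h10
  rw [h11] at hD
  exact (sub_eq_zero.mp hD.symm)

section
variable {H : Type*} [NormedAddCommGroup H] [InnerProductSpace ℂ H] [CompleteSpace H]

theorem aux_oabs_nonneg (A : H →L[ℂ] H) : 0 ≤ oabs A :=
  cfc_nonneg fun x _ => Real.sqrt_nonneg x

theorem aux_oabs_mul (A : H →L[ℂ] H) : oabs A * oabs A = adjoint A * A := by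
  have h0 : 0 ≤ adjoint A * A := star_mul_self_nonneg A
  unfold oabs
  rw [← cfc_mul Real.sqrt Real.sqrt (adjoint A * A)]
  conv_rhs => rw [← cfc_id ℝ (adjoint A * A)]
  apply cfc_congr
  intro x hx
  exact Real.mul_self_sqrt (spectrum_nonneg_of_nonneg h0 hx)

theorem aux_norm_oabs (A : H →L[ℂ] H) : ‖oabs A‖ = ‖A‖ := by
  have h1 : ‖oabs A‖ * ‖oabs A‖ = ‖A‖ * ‖A‖ := by
    rw [← CStarRing.norm_star_mul_self (x := A), ← CStarRing.norm_star_mul_self (x := oabs A),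
      (IsSelfAdjoint.of_nonneg (aux_oabs_nonneg A)).star_eq, aux_oabs_mul]
    rfl
  exact (mul_self_inj (norm_nonneg _) (norm_nonneg _)).mp h1

theorem aux_sqrt (P : H →L[ℂ] H) (hP : 0 ≤ P) :
    ∃ S : H →L[ℂ] H, adjoint S = S ∧ S * S = P :=
  ⟨CFC.sqrt P, (IsSelfAdjoint.of_nonneg (CFC.sqrt_nonneg P)).star_eq, CFC.sqrt_mul_sqrt_self P hP⟩

theorem aux_inner_sq {P S : H →L[ℂ] H} (hS : adjoint S = S) (h : S * S = P) (x y : H) :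
    inner ℂ (P x) y = inner ℂ (S x) (S y) := by
  rw [← h, mul_apply_eq_comp, ← adjoint_inner_right, hS]

/-- The Reid inequality. -/
theorem aux_reid {B S : H →L[ℂ] H} (hS : adjoint S = S) (h : S * S * B = adjoint B * (S * S))
    (x : H) : ‖S (B x)‖ ≤ (spectralRadius ℂ B).toReal * ‖S x‖ := by
  have comm : ∀ k : ℕ, S * S * B ^ k = adjoint (B ^ k) * (S * S) := by
    intro k
    induction k with
    | zero => simp [← star_eq_adjoint]
    | succ k ih =>
      rw [pow_succ, ← mul_assoc, ih, mul_assoc, h, ← mul_assoc, ← pow_succ, pow_succ',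
        ← star_eq_adjoint, ← star_eq_adjoint, ← star_eq_adjoint, star_mul]
  have step : ∀ k : ℕ, ‖S ((B ^ k) x)‖ ^ 2 ≤ ‖S ((B ^ (k + k)) x)‖ * ‖S x‖ := by
    intro k
    have e : inner ℂ (S ((B ^ k) x)) (S ((B ^ k) x)) = inner ℂ (S ((B ^ (k + k)) x)) (S x) := by
      rw [← aux_inner_sq hS rfl, ← aux_inner_sq hS rfl, ← adjoint_inner_left]
      congr 1
      change (adjoint (B ^ k) * (S * S)) ((B ^ k) x) = _
      rw [← comm, pow_add]
      rfl
    calc ‖S ((B ^ k) x)‖ ^ 2 = ‖inner ℂ (S ((B ^ k) x)) (S ((B ^ k) x))‖ := by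
          rw [inner_self_eq_norm_sq_to_K]; simp
      _ ≤ _ := by rw [e]; exact norm_inner_le_norm _ _
  rcases (norm_nonneg (S x)).eq_or_lt with h0 | hpos
  · have := step 1
    rw [← h0, mul_zero, pow_one] at this
    rw [← h0, mul_zero]
    nlinarith [norm_nonneg (S (B x))]
  have iter : ∀ m : ℕ, (‖S (B x)‖ / ‖S x‖) ^ (2 ^ m) ≤ ‖S ((B ^ (2 ^ m)) x)‖ / ‖S x‖ := by
    intro m
    induction m with
    | zero => simp
    | succ m ih =>
      rw [pow_succ 2 m, pow_mul]
      calc ((‖S (B x)‖ / ‖S x‖) ^ (2 ^ m)) ^ 2 ≤ (‖S ((B ^ (2 ^ m)) x)‖ / ‖S x‖) ^ 2 := by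
            gcongr
        _ ≤ _ := by
            rw [div_pow, div_le_div_iff₀ (by positivity) hpos, mul_two]
            nlinarith [step (2 ^ m)]
  set t := ‖S (B x)‖ / ‖S x‖ with ht
  set M := ‖S‖ * ‖x‖ / ‖S x‖ + 1 with hM
  have hMpos : 0 < M := by positivity
  have bd : ∀ m : ℕ, t ^ (2 ^ m) ≤ M * ‖B ^ (2 ^ m)‖ := by
    intro m
    refine (iter m).trans ?_
    rw [div_le_iff₀ hpos]
    calc ‖S ((B ^ (2 ^ m)) x)‖ ≤ ‖S‖ * (‖B ^ (2 ^ m)‖ * ‖x‖) :=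
          (S.le_opNorm _).trans (by gcongr; exact le_opNorm _ _)
      _ = (‖S‖ * ‖x‖ / ‖S x‖) * ‖B ^ (2 ^ m)‖ * ‖S x‖ := by field_simp
      _ ≤ _ := by gcongr; rw [hM]; linarith
  have hfin : spectralRadius ℂ B ≠ ⊤ :=
    ((spectrum.spectralRadius_le_pow_nnnorm_pow_one_div ℂ B 0).trans_lt (by
      simpa using ENNReal.mul_lt_top (by simp) (by simp))).ne
  have lim1 : Filter.Tendsto (fun n : ℕ => ‖B ^ n‖ ^ (1 / n : ℝ)) Filter.atTop
      (nhds (spectralRadius ℂ B).toReal) := by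
    have := (ENNReal.tendsto_toReal hfin).comp
      (spectrum.pow_norm_pow_one_div_tendsto_nhds_spectralRadius B)
    refine this.congr fun n => ?_
    exact ENNReal.toReal_ofReal (by positivity)
  have lim2 : Filter.Tendsto (fun n : ℕ => M ^ (1 / n : ℝ)) Filter.atTop (nhds 1) := by
    have := (Real.continuous_const_rpow hMpos.ne').tendsto 0 |>.comp
      (tendsto_one_div_atTop_nhds_zero_nat (𝕜 := ℝ))
    rw [Real.rpow_zero] at this
    exact this
  have lim3 := (lim2.mul lim1).comp (tendsto_pow_atTop_atTop_of_one_lt (r := 2) (by norm_num))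
  have : t ≤ 1 * (spectralRadius ℂ B).toReal := by
    refine ge_of_tendsto' lim3 fun m => ?_
    have ht0 : 0 ≤ t := by positivity
    have hne : (2 ^ m : ℕ) ≠ 0 := by positivity
    simp only [Function.comp]
    rw [← Real.mul_rpow hMpos.le (norm_nonneg _)]
    calc t = (t ^ (2 ^ m : ℕ)) ^ (1 / ((2 ^ m : ℕ) : ℝ)) := by
          rw [one_div, Real.pow_rpow_inv_natCast ht0 hne]
      _ ≤ _ := by
          apply Real.rpow_le_rpow (by positivity) (bd m) (by positivity)
  rw [one_mul, ht, div_le_iff₀ hpos] at this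
  exact this

theorem aux_cs {P : H →L[ℂ] H} (hP : 0 ≤ P) (x y : H) :
    ‖inner ℂ (P x) y‖ ^ 2 ≤ (inner ℂ (P x) x).re * (inner ℂ (P y) y).re := by
  obtain ⟨S, hS, h⟩ := aux_sqrt P hP
  have e : ∀ z, (inner ℂ (P z) z).re = ‖S z‖ ^ 2 := fun z => by
    rw [aux_inner_sq hS h]; exact inner_self_eq_norm_sq (𝕜 := ℂ) _
  rw [e, e, aux_inner_sq hS h, ← mul_pow]
  gcongr
  exact norm_inner_le_norm _ _

theorem aux_mixed {A X Y S T : H →L[ℂ] H} (hX : 0 ≤ X) (hY : 0 ≤ Y)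
    (hXX : X * X = adjoint A * A) (hYY : Y * Y = A * adjoint A)
    (hS : adjoint S = S) (hSX : S * S = X) (hT : adjoint T = T) (hTY : T * T = Y) (x y : H) :
    ‖inner ℂ (A x) y‖ ≤ ‖S x‖ * ‖T y‖ := by
  have hi : A * X = Y * A := aux_intertwine hX hY (by rw [hXX, hYY, mul_assoc])
  have sY : adjoint Y = Y := (IsSelfAdjoint.of_nonneg hY).star_eq
  have key : ∀ ε : ℝ, 0 < ε →
      ‖inner ℂ (A x) y‖ ^ 2 ≤ (‖S x‖ ^ 2 + ε * ‖x‖ ^ 2) * ‖T y‖ ^ 2 := by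
    intro ε hε
    have e0 : ∀ z : H, (inner ℂ z z).re = ‖z‖ ^ 2 := fun z => inner_self_eq_norm_sq (𝕜 := ℂ) z
    have e1 : ∀ z, (inner ℂ (X z) z).re = ‖S z‖ ^ 2 := fun z => by
      rw [aux_inner_sq hS hSX]; exact inner_self_eq_norm_sq (𝕜 := ℂ) _
    have e2 : ∀ z, (inner ℂ (Y z) z).re = ‖T z‖ ^ 2 := fun z => by
      rw [aux_inner_sq hT hTY]; exact inner_self_eq_norm_sq (𝕜 := ℂ) _
    have hXε : 0 ≤ X + (ε : ℂ) • (1 : H →L[ℂ] H) := by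
      apply add_nonneg hX
      rw [nonneg_iff_isPositive]
      exact isPositive_one.smul_of_nonneg (by exact_mod_cast hε.le)
    have hunit : IsUnit (Y + (ε : ℂ) • (1 : H →L[ℂ] H)) := by
      apply isUnit_of_forall_le_norm_inner_map _ (c := ⟨ε, hε.le⟩) hε
      intro z
      refine le_trans ?_ (Complex.re_le_norm _)
      simp only [add_apply, smul_apply, one_apply_eq_self, inner_add_left, inner_smul_left, Complex.add_re, e2,
        Complex.re_ofReal_mul, e0, Complex.conj_ofReal]
      change ‖z‖ ^ 2 * ε ≤ _
      nlinarith [sq_nonneg ‖T z‖]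
    obtain ⟨z, rfl⟩ : ∃ z, (Y + (ε : ℂ) • (1 : H →L[ℂ] H)) z = y := by
      obtain ⟨u, hu⟩ := hunit
      refine ⟨(↑u⁻¹ : H →L[ℂ] H) y, ?_⟩
      rw [← hu]
      change ((u : H →L[ℂ] H) * (↑u⁻¹ : H →L[ℂ] H)) y = y
      simp
    have hswap : inner ℂ (A x) ((Y + (ε : ℂ) • (1 : H →L[ℂ] H)) z)
        = inner ℂ ((X + (ε : ℂ) • (1 : H →L[ℂ] H)) x) (adjoint A z) := by
      have hi' : A (X x) = Y (A x) := congrArg (fun L : H →L[ℂ] H => L x) hi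
      have : inner ℂ (A x) (Y z) = inner ℂ (Y (A x)) z := by
        rw [← adjoint_inner_left, sY]
      simp only [add_apply, smul_apply, one_apply_eq_self, inner_add_left, inner_add_right, inner_smul_left,
        inner_smul_right, adjoint_inner_right, map_add, map_smul, this, hi', Complex.conj_ofReal]
    rw [hswap]
    refine (aux_cs hXε _ _).trans ?_
    have f1 : (inner ℂ ((X + (ε : ℂ) • (1 : H →L[ℂ] H)) x) x).re = ‖S x‖ ^ 2 + ε * ‖x‖ ^ 2 := by
      simp only [add_apply, smul_apply, one_apply_eq_self, inner_add_left, inner_smul_left, Complex.add_re, e1,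
        Complex.re_ofReal_mul, e0, Complex.conj_ofReal]
    rw [f1]
    gcongr
    have hYadj : ∀ u v : H, inner ℂ (Y u) v = inner ℂ u (Y v) := fun u v => by
      rw [← adjoint_inner_left, sY]
    have hYY' : ∀ v, A (adjoint A v) = Y (Y v) := fun v =>
      congrArg (fun L : H →L[ℂ] H => L v) hYY.symm
    have g1 : inner ℂ (X (adjoint A z)) (adjoint A z) = inner ℂ (Y (Y z)) (Y z) := by
      rw [adjoint_inner_right]
      have : A (X (adjoint A z)) = Y (A (adjoint A z)) :=
        congrArg (fun L : H →L[ℂ] H => L (adjoint A z)) hi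
      rw [this, hYY', hYadj]
    have g2 : inner ℂ (adjoint A z) (adjoint A z) = inner ℂ (Y z) (Y z) := by
      rw [adjoint_inner_right, hYY', hYadj]
    have g3 : inner ℂ (Y (Y z)) z = inner ℂ (Y z) (Y z) := hYadj _ _
    rw [← e2]
    simp only [add_apply, smul_apply, one_apply_eq_self, map_add, map_smul, inner_add_left, inner_add_right,
      inner_smul_left, inner_smul_right, Complex.conj_ofReal, g1, g2, g3, Complex.add_re,
      Complex.re_ofReal_mul, e2]
    have : (inner ℂ (Y z) (Y z)).re = ‖Y z‖ ^ 2 := by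
      exact inner_self_eq_norm_sq (𝕜 := ℂ) _
    rw [this]
    have : 0 ≤ ε * (ε * ‖T z‖ ^ 2) := by positivity
    have : 0 ≤ ε * ‖Y z‖ ^ 2 := by positivity
    linarith
  have hlim : Filter.Tendsto (fun ε : ℝ => (‖S x‖ ^ 2 + ε * ‖x‖ ^ 2) * ‖T y‖ ^ 2)
      (nhdsWithin 0 (Set.Ioi 0)) (nhds ((‖S x‖ ^ 2 + 0 * ‖x‖ ^ 2) * ‖T y‖ ^ 2)) :=
    Filter.Tendsto.mono_left (Continuous.tendsto (by fun_prop) 0) nhdsWithin_le_nhds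
  have := ge_of_tendsto hlim (Filter.eventually_of_mem self_mem_nhdsWithin key)
  rw [zero_mul, add_zero, ← mul_pow] at this
  exact le_of_sq_le_sq this (by positivity)

theorem aux_norm_fg (A : H →L[ℂ] H) (f g : ℝ → ℝ) (hf : Continuous f) (hg : Continuous g)
    (hf0 : ∀ t : ℝ, 0 ≤ t → 0 ≤ f t) (hfg : ∀ t : ℝ, 0 ≤ t → f t * g t = t) :
    ‖A‖ ≤ ‖cfc f (oabs A)‖ * ‖cfc g (oabs (adjoint A))‖ := by
  rcases subsingleton_or_nontrivial H with hs | hs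
  · have : A = 0 := by ext x; exact Subsingleton.elim _ _
    rw [this, norm_zero]; positivity
  have m : ∀ A : H →L[ℂ] H, ‖A‖ ∈ spectrum ℝ (oabs A) := fun A => by
    rw [← aux_norm_oabs A]
    exact CStarAlgebra.norm_mem_spectrum_of_nonneg (aux_oabs_nonneg A)
  have h1 := norm_apply_le_norm_cfc f (oabs A) (m A) hf.continuousOn
    (IsSelfAdjoint.of_nonneg (aux_oabs_nonneg A))
  have h2 := norm_apply_le_norm_cfc g (oabs (adjoint A)) (m _) hg.continuousOn
    (IsSelfAdjoint.of_nonneg (aux_oabs_nonneg _))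
  rw [LinearIsometryEquiv.norm_map] at h2
  calc ‖A‖ = ‖f ‖A‖‖ * ‖g ‖A‖‖ := by
        rw [← norm_mul, hfg _ (norm_nonneg _), norm_norm]
    _ ≤ _ := by gcongr

theorem aux_single (A B C : H →L[ℂ] H) (hAB : oabs A * B = adjoint B * oabs A)
    (hAC : oabs (adjoint A) * C = adjoint C * oabs (adjoint A)) :
    ‖adjoint C * A * B‖ ≤
      (spectralRadius ℂ B).toReal * (spectralRadius ℂ C).toReal * ‖A‖ := by
  obtain ⟨S, hS, hSX⟩ := aux_sqrt _ (aux_oabs_nonneg A)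
  obtain ⟨T, hT, hTY⟩ := aux_sqrt _ (aux_oabs_nonneg (adjoint A))
  have nS : ‖S‖ * ‖S‖ = ‖A‖ := by
    rw [← aux_norm_oabs A, ← hSX, ← CStarRing.norm_star_mul_self (x := S), star_eq_adjoint, hS]
  have nT : ‖T‖ * ‖T‖ = ‖A‖ := by
    rw [← LinearIsometryEquiv.norm_map adjoint A, ← aux_norm_oabs (adjoint A), ← hTY,
      ← CStarRing.norm_star_mul_self (x := T), star_eq_adjoint, hT]
  have nST : ‖S‖ = ‖T‖ :=
    (mul_self_inj (norm_nonneg _) (norm_nonneg _)).mp (nS.trans nT.symm)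
  refine ContinuousLinearMap.opNorm_le_of_re_inner_le (by positivity) ?_
  intro x y hx hy
  refine (RCLike.re_le_norm _).trans ?_
  have e : inner ℂ ((adjoint C * A * B) x) y = inner ℂ (A (B x)) (C y) := by
    rw [← adjoint_inner_left]; rfl
  rw [e]
  have hYY : oabs (adjoint A) * oabs (adjoint A) = A * adjoint A := by
    rw [aux_oabs_mul, adjoint_adjoint]
  have h1 := aux_mixed (aux_oabs_nonneg A) (aux_oabs_nonneg (adjoint A)) (aux_oabs_mul A) hYY
    hS hSX hT hTY (B x) (C y)
  have h2 := aux_reid hS (by rw [hSX]; exact hAB) x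
  have h3 := aux_reid hT (by rw [hTY]; exact hAC) y
  have h4 : ‖S x‖ ≤ ‖S‖ := by simpa [hx] using S.le_opNorm x
  have h5 : ‖T y‖ ≤ ‖T‖ := by simpa [hy] using T.le_opNorm y
  calc _ ≤ ‖S (B x)‖ * ‖T (C y)‖ := h1
    _ ≤ ((spectralRadius ℂ B).toReal * ‖S‖) * ((spectralRadius ℂ C).toReal * ‖T‖) := by
        gcongr
        · exact h2.trans (by gcongr)
        · exact h3.trans (by gcongr)
    _ = _ := by rw [← nS, nST]; ring
end

theorem stmt7 {H : Type*} [NormedAddCommGroup H] [InnerProductSpace ℂ H] [CompleteSpace H]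
    (n : ℕ) (hn : 0 < n) (A B C : Fin n → (H →L[ℂ] H)) (f g : ℝ → ℝ) (hf : Continuous f) (hg : Continuous g)
    (hf0 : ∀ t : ℝ, 0 ≤ t → 0 ≤ f t) (hg0 : ∀ t : ℝ, 0 ≤ t → 0 ≤ g t)
    (hfg : ∀ t : ℝ, 0 ≤ t → f t * g t = t)
    (hAB : ∀ i, oabs (A i) * B i = adjoint (B i) * oabs (A i))
    (hAC : ∀ i, oabs (adjoint (A i)) * C i = adjoint (C i) * oabs (adjoint (A i)))
    (p q : ℝ) (hp : 1 < p) (hq : 1 < q) (hpq : 1 / p + 1 / q = 1) :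
    haveI : Nonempty (Fin n) := Fin.pos_iff_nonempty.mp hn
    ‖∑ i, adjoint (C i) * A i * B i‖ ≤
      (⨆ i, (spectralRadius ℂ (B i)).toReal * (spectralRadius ℂ (C i)).toReal) *
        (∑ i, ‖cfc f (oabs (A i))‖ ^ p) ^ (1 / p) *
        (∑ i, ‖cfc g (oabs (adjoint (A i)))‖ ^ q) ^ (1 / q) := by
  have hne : Nonempty (Fin n) := Fin.pos_iff_nonempty.mp hn
  set M := ⨆ i, (spectralRadius ℂ (B i)).toReal * (spectralRadius ℂ (C i)).toReal with hM
  have hle : ∀ i, (spectralRadius ℂ (B i)).toReal * (spectralRadius ℂ (C i)).toReal ≤ M :=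
    fun i => le_ciSup (f := fun i => (spectralRadius ℂ (B i)).toReal *
      (spectralRadius ℂ (C i)).toReal) (Set.finite_range _).bddAbove i
  have hM0 : 0 ≤ M := le_trans (by positivity) (hle ⟨0, hn⟩)
  have hconj : p.HolderConjugate q := by
    rw [Real.holderConjugate_iff]
    exact ⟨hp, by simpa using hpq⟩
  calc ‖∑ i, adjoint (C i) * A i * B i‖ ≤ ∑ i, ‖adjoint (C i) * A i * B i‖ := norm_sum_le _ _
    _ ≤ ∑ i, M * (‖cfc f (oabs (A i))‖ * ‖cfc g (oabs (adjoint (A i)))‖) := by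
        apply Finset.sum_le_sum
        intro i _
        refine (aux_single _ _ _ (hAB i) (hAC i)).trans ?_
        exact mul_le_mul (hle i) (aux_norm_fg (A i) f g hf hg hf0 hfg) (norm_nonneg _) hM0
    _ ≤ _ := by
        rw [← Finset.mul_sum, mul_assoc]
        apply mul_le_mul_of_nonneg_left _ hM0
        exact Real.inner_le_Lp_mul_Lq_of_nonneg _ hconj (fun _ _ => norm_nonneg _)
          (fun _ _ => norm_nonneg _)
end

section
/- Let C ∈ B(H) be such that |C*|C = C*|C*|, and let f, g be nonnegative continuous functions on [0,∞) satisfying f(t)g(t) = t for all t ≥ 0. Then the numerical radius satisfies w(C*C) ≤ (1/2) · r(C) · ‖f(|C|)² + g(|C*|)²‖; equivalently, for every unit vector x ∈ H, |⟨C*Cx, x⟩| ≤ (1/2) · r(C) · ‖f(|C|)² + g(|C*|)²‖. -/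
open scoped InnerProductSpace
open ContinuousLinearMap

lemma oabs_nonneg' {H : Type*} [NormedAddCommGroup H] [InnerProductSpace ℂ H]
    [CompleteSpace H] (A : H →L[ℂ] H) : 0 ≤ oabs A :=
  cfc_nonneg fun x _ => Real.sqrt_nonneg x

lemma oabs_mul_self' {H : Type*} [NormedAddCommGroup H] [InnerProductSpace ℂ H]
    [CompleteSpace H] (A : H →L[ℂ] H) : oabs A * oabs A = star A * A := by
  have h0 : 0 ≤ star A * A := star_mul_self_nonneg A
  have hsa : IsSelfAdjoint (star A * A) := IsSelfAdjoint.star_mul_self A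
  change cfc Real.sqrt (star A * A) * cfc Real.sqrt (star A * A) = _
  rw [← cfc_mul Real.sqrt Real.sqrt (star A * A)]
  conv_rhs => rw [← cfc_id ℝ (star A * A)]
  apply cfc_congr
  intro t ht
  exact Real.mul_self_sqrt (spectrum_nonneg_of_nonneg h0 ht)

lemma aux_cancel_star {A : Type*} [CStarAlgebra A] (c y : A) (h : c * star c * y = 0) :
    star c * y = 0 := by
  rw [← CStarRing.star_mul_self_eq_zero_iff, star_mul, star_star]
  calc star y * c * (star c * y) = star y * (c * star c * y) := by noncomm_ring
    _ = 0 := by rw [h, mul_zero]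

lemma selfAdjoint_of_comm' {A : Type*} [CStarAlgebra A] (c p : A)
    (hp : star p = p) (hpp : p * p = c * star c) (h : p * c = star c * p)
    (hcomm : Commute (p * c) p) : star c = c := by
  have hX : c * p - p * c = 0 := by
    have h1 : p * (c * p - p * c) = 0 := by
      have := hcomm.eq
      rw [mul_sub, ← mul_assoc, this, sub_self]
    have h2 : star c * (c * p - p * c) = 0 := by
      apply aux_cancel_star
      rw [← hpp, mul_assoc, h1, mul_zero]
    rw [← CStarRing.star_mul_self_eq_zero_iff]
    calc star (c * p - p * c) * (c * p - p * c)
        = p * (star c * (c * p - p * c)) - star c * (p * (c * p - p * c)) := by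
          rw [star_sub, star_mul, star_mul, hp]; noncomm_ring
      _ = 0 := by rw [h1, h2]; simp
  have hcp : c * p = p * c := sub_eq_zero.mp hX
  have hq : c * (c * star c) = (c * star c) * c := by
    rw [← hpp, ← mul_assoc, hcp, mul_assoc, hcp, mul_assoc]
  have h1 : star c * (star c - c) = 0 := by
    apply aux_cancel_star
    rw [← hpp, mul_assoc]
    have : p * (star c - c) = 0 := by
      have h3 : star (c * p) = star (star c * p) := by rw [hcp, h]
      rw [star_mul, star_mul, star_star, hp] at h3
      rw [mul_sub, h3, sub_self]
    rw [this, mul_zero]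
  have e1 : star c * star c = star c * c := by
    rw [mul_sub] at h1; exact sub_eq_zero.mp h1
  have e2 : c * c = star c * c := by
    have := congrArg star e1
    simpa using this
  have hD1 : c * (c * star c - star c * c) = 0 := by
    rw [mul_sub, hq, mul_assoc, sub_self]
  have hD2 : star c * (c * star c - star c * c) = 0 := by
    rw [mul_sub, ← mul_assoc, ← e1, mul_assoc, e1, sub_self]
  have hD : c * star c - star c * c = 0 := by
    rw [← CStarRing.star_mul_self_eq_zero_iff]
    calc star (c * star c - star c * c) * (c * star c - star c * c)
        = c * (star c * (c * star c - star c * c))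
          - star c * (c * (c * star c - star c * c)) := by
          simp only [star_sub, star_mul, star_star]; noncomm_ring
      _ = 0 := by rw [hD1, hD2]; simp
  rw [← sub_eq_zero, ← CStarRing.star_mul_self_eq_zero_iff]
  calc star (star c - c) * (star c - c)
      = (c * star c - star c * c) + (star c * c - c * c) + (star c * c - star c * star c) := by
        simp only [star_sub, star_star]; noncomm_ring
    _ = 0 := by rw [hD, e1, e2]; simp

theorem stmt12 {H : Type*} [NormedAddCommGroup H] [InnerProductSpace ℂ H] [CompleteSpace H]
    (C : H →L[ℂ] H) (f g : ℝ → ℝ) (hf : Continuous f) (hg : Continuous g)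
    (hf0 : ∀ t : ℝ, 0 ≤ t → 0 ≤ f t) (hg0 : ∀ t : ℝ, 0 ≤ t → 0 ≤ g t)
    (hfg : ∀ t : ℝ, 0 ≤ t → f t * g t = t)
    (hC : oabs (adjoint C) * C = adjoint C * oabs (adjoint C))
    (x : H) (hx : ‖x‖ = 1) :
    ‖⟪(adjoint C * C) x, x⟫_ℂ‖ ≤
      1 / 2 * (spectralRadius ℂ C).toReal *
        ‖(cfc f (oabs C)) ^ 2 + (cfc g (oabs (adjoint C))) ^ 2‖ := by
  have hsa : star C = C := by
    have hP0 := oabs_nonneg' (adjoint C)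
    have hPP : oabs (adjoint C) * oabs (adjoint C) = C * star C := by
      have := oabs_mul_self' (adjoint C)
      rwa [← star_eq_adjoint, star_star] at this
    have hPs : star (oabs (adjoint C)) = oabs (adjoint C) :=
      (IsSelfAdjoint.of_nonneg hP0).star_eq
    have hPdef : oabs (adjoint C) = cfc Real.sqrt (C * star C) := by
      rw [oabs, ← star_eq_adjoint, ← star_eq_adjoint, star_star]
    rw [← star_eq_adjoint] at hC hP0 hPP hPs hPdef
    generalize oabs (star C) = P at *
    refine selfAdjoint_of_comm' C P hPs hPP hC ?_
    have hQ0 : 0 ≤ C * star C := mul_star_self_nonneg C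
    have hMM : (P * C) * (P * C) = (C * star C) * (C * star C) := by
      nth_rewrite 2 [hC]
      calc P * C * (star C * P) = P * (C * star C) * P := by noncomm_ring
        _ = (P * P) * (P * P) := by rw [← hPP]; noncomm_ring
        _ = _ := by rw [hPP]
    have c1 : Commute ((C * star C) * (C * star C)) (P * C) := by
      rw [← hMM]; exact (Commute.refl _).mul_left (Commute.refl _)
    have c2 : Commute (C * star C) (P * C) := by
      have hs : CFC.sqrt ((C * star C) * (C * star C)) = C * star C := CFC.sqrt_mul_self _ hQ0
      rw [← hs, CFC.sqrt_eq_cfc]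
      exact c1.cfc_nnreal _
    rw [hPdef]
    rw [hPdef] at c2
    exact (c2.cfc_real _).symm
  have hsa' : IsSelfAdjoint C := hsa
  rw [← star_eq_adjoint, hsa, hsa'.spectralRadius_eq_nnnorm]
  have hT0 := oabs_nonneg' C
  have hTT := oabs_mul_self' C
  have hTs : IsSelfAdjoint (oabs C) := IsSelfAdjoint.of_nonneg hT0
  have hTn : ‖oabs C‖ = ‖C‖ := by
    have h1 : ‖oabs C‖ * ‖oabs C‖ = ‖C‖ * ‖C‖ := by
      rw [← CStarRing.norm_star_mul_self, hTs.star_eq, hTT, CStarRing.norm_star_mul_self]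
    exact (mul_self_inj (norm_nonneg _) (norm_nonneg _)).mp h1
  have key : 2 * ‖C‖ ≤ ‖(cfc f (oabs C)) ^ 2 + (cfc g (oabs C)) ^ 2‖ := by
    generalize oabs C = T at *
    rw [← cfc_pow f 2 T, ← cfc_pow g 2 T, ← cfc_add T (fun t => f t ^ 2) (fun t => g t ^ 2)]
    have h2 : (2 : ℝ) • T ≤ cfc (fun t => f t ^ 2 + g t ^ 2) T := by
      conv_lhs => rw [← cfc_id ℝ T, ← cfc_smul (2:ℝ) id T]
      rw [cfc_le_iff _ _ T]
      intro t ht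
      have ht0 : 0 ≤ t := spectrum_nonneg_of_nonneg hT0 ht
      have := hfg t ht0
      simp only [id, smul_eq_mul]
      nlinarith [sq_nonneg (f t - g t)]
    have := CStarAlgebra.norm_le_norm_of_nonneg_of_le (smul_nonneg zero_le_two hT0) h2
    rw [norm_smul, hTn] at this
    simpa using this
  have hl : ‖⟪(C * C) x, x⟫_ℂ‖ ≤ ‖C‖ * ‖C‖ := by
    calc _ ≤ ‖(C * C) x‖ * ‖x‖ := norm_inner_le_norm _ _
      _ ≤ ‖C * C‖ * ‖x‖ * ‖x‖ := by gcongr; exact le_opNorm _ _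
      _ ≤ _ := by rw [hx]; simpa using norm_mul_le C C
  have := mul_le_mul_of_nonneg_left key (norm_nonneg C)
  simp only [ENNReal.coe_toReal, coe_nnnorm]
  linarith
end

section
/- Let A ∈ B(H) have Cartesian decomposition A = P + iQ, where P and Q are selfadjoint, and let f, g be nonnegative continuous functions on [0,∞) satisfying f(t)g(t) = t for all t ≥ 0. Let p, q ≥ 2 with 1/p + 1/q = 1. Then the numerical radius satisfies w(A) ≤ ‖f(|P|)^p + f(|Q|)^p‖^{1/p} · ‖g(|P|)^q + g(|Q|)^q‖^{1/q}; equivalently, for every unit vector x ∈ H, |⟨Ax, x⟩| ≤ ‖f(|P|)^p + f(|Q|)^p‖^{1/p} · ‖g(|P|)^q + g(|Q|)^q‖^{1/q}. -/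
open scoped InnerProductSpace
open ContinuousLinearMap

theorem oabs_eq_cfc_abs {H : Type*} [NormedAddCommGroup H] [InnerProductSpace ℂ H]
    [CompleteSpace H] (P : H →L[ℂ] H) (hP : IsSelfAdjoint P) :
    oabs P = cfc (fun t : ℝ => |t|) P := by
  have h1 : adjoint P * P = cfc (fun t : ℝ => t ^ 2) P := by
    rw [cfc_pow_id (R := ℝ) P 2, sq]
    congr 1
  unfold oabs
  rw [h1, ← cfc_comp' Real.sqrt (fun t : ℝ => t ^ 2) P]
  simp only [Real.sqrt_sq_eq_abs]

theorem cfc_oabs {H : Type*} [NormedAddCommGroup H] [InnerProductSpace ℂ H]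
    [CompleteSpace H] (P : H →L[ℂ] H) (hP : IsSelfAdjoint P) (f : ℝ → ℝ) (hf : Continuous f) :
    cfc f (oabs P) = cfc (fun t : ℝ => f |t|) P := by
  rw [oabs_eq_cfc_abs P hP, ← cfc_comp' f (fun t : ℝ => |t|) P (by fun_prop) (by fun_prop)]

theorem inner_le_oabs {H : Type*} [NormedAddCommGroup H] [InnerProductSpace ℂ H]
    [CompleteSpace H] (P : H →L[ℂ] H) (hP : IsSelfAdjoint P) (f g : ℝ → ℝ)
    (hf : Continuous f) (hg : Continuous g)
    (hfg : ∀ t : ℝ, 0 ≤ t → f t * g t = t) (x : H) :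
    ‖⟪P x, x⟫_ℂ‖ ≤ ‖cfc f (oabs P) x‖ * ‖cfc g (oabs P) x‖ := by
  have hs : IsSelfAdjoint (cfc f (oabs P)) := cfc_predicate f _
  have hm : cfc f (oabs P) * cfc g (oabs P) = cfc (fun t : ℝ => |t|) P := by
    rw [cfc_oabs P hP f hf, cfc_oabs P hP g hg, ← cfc_mul _ _ P (by fun_prop) (by fun_prop)]
    congr 1
    ext t
    exact hfg _ (abs_nonneg t)
  have h1 : P ≤ cfc (fun t : ℝ => |t|) P := by
    conv_lhs => rw [← cfc_id' ℝ P]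
    exact cfc_mono (fun t _ => le_abs_self t)
  have h2 : -P ≤ cfc (fun t : ℝ => |t|) P := by
    conv_lhs => rw [← cfc_id' ℝ P, ← cfc_neg]
    exact cfc_mono (fun t _ => neg_le_abs t)
  rw [← hm, ContinuousLinearMap.le_def] at h1 h2
  have h1' := h1.re_inner_nonneg_left x
  have h2' := h2.re_inner_nonneg_left x
  have key : RCLike.re ⟪(cfc f (oabs P) * cfc g (oabs P)) x, x⟫_ℂ ≤
      ‖cfc f (oabs P) x‖ * ‖cfc g (oabs P) x‖ := by
    have : ⟪(cfc f (oabs P) * cfc g (oabs P)) x, x⟫_ℂ = ⟪cfc g (oabs P) x, cfc f (oabs P) x⟫_ℂ := by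
      rw [ContinuousLinearMap.mul_apply]
      exact hs.isSymmetric _ _
    rw [this, mul_comm]
    exact re_inner_le_norm _ _
  have hr : ‖⟪P x, x⟫_ℂ‖ = |RCLike.re ⟪P x, x⟫_ℂ| := by
    have := hP.isSymmetric.coe_re_inner_apply_self x
    have h3 : ((RCLike.re ⟪P x, x⟫_ℂ : ℝ) : ℂ) = ⟪P x, x⟫_ℂ := this
    rw [← h3, Complex.norm_real]
    simp
  simp only [ContinuousLinearMap.sub_apply, ContinuousLinearMap.neg_apply, inner_sub_left,
    inner_neg_left, map_sub, map_neg] at h1' h2'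
  rw [hr]
  exact (abs_le'.2 ⟨by linarith, by linarith⟩).trans key

theorem norm_sq_le_norm_cfc {H : Type*} [NormedAddCommGroup H] [InnerProductSpace ℂ H]
    [CompleteSpace H] (P Q : H →L[ℂ] H) (f : ℝ → ℝ)
    (hf : Continuous f) (x : H) (hx : ‖x‖ = 1) :
    ‖cfc f (oabs P) x‖ ^ 2 + ‖cfc f (oabs Q) x‖ ^ 2 ≤
      ‖cfc (fun t : ℝ => f t ^ (2 : ℝ)) (oabs P) + cfc (fun t : ℝ => f t ^ (2 : ℝ)) (oabs Q)‖ := by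
  have aux : ∀ P : H →L[ℂ] H, ‖cfc f (oabs P) x‖ ^ 2 =
      RCLike.re ⟪cfc (fun t : ℝ => f t ^ (2 : ℝ)) (oabs P) x, x⟫_ℂ := by
    intro P
    have ho : IsSelfAdjoint (oabs P) := cfc_predicate _ _
    have hs : IsSelfAdjoint (cfc f (oabs P)) := cfc_predicate f _
    have : cfc (fun t : ℝ => f t ^ (2 : ℝ)) (oabs P) = cfc f (oabs P) * cfc f (oabs P) := by
      rw [← cfc_mul f f (oabs P) (by fun_prop) (by fun_prop)]
      congr 1
      ext t
      rw [Real.rpow_two, sq]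
    rw [this, ContinuousLinearMap.mul_apply]
    have h := hs.isSymmetric (cfc f (oabs P) x) x
    simp only [ContinuousLinearMap.coe_coe] at h
    rw [h, inner_self_eq_norm_sq]
  rw [aux, aux, ← map_add, ← inner_add_left, ← ContinuousLinearMap.add_apply]
  refine (re_inner_le_norm _ _).trans ?_
  rw [hx, mul_one]
  refine (ContinuousLinearMap.le_opNorm _ _).trans ?_
  rw [hx, mul_one]

theorem stmt18 {H : Type*} [NormedAddCommGroup H] [InnerProductSpace ℂ H] [CompleteSpace H]
    (A P Q : H →L[ℂ] H) (hP : IsSelfAdjoint P) (hQ : IsSelfAdjoint Q)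
    (hA : A = P + Complex.I • Q) (f g : ℝ → ℝ) (hf : Continuous f) (hg : Continuous g)
    (hf0 : ∀ t : ℝ, 0 ≤ t → 0 ≤ f t) (hg0 : ∀ t : ℝ, 0 ≤ t → 0 ≤ g t)
    (hfg : ∀ t : ℝ, 0 ≤ t → f t * g t = t)
    (p q : ℝ) (hp : 2 ≤ p) (hq : 2 ≤ q) (hpq : 1 / p + 1 / q = 1)
    (x : H) (hx : ‖x‖ = 1) :
    ‖⟪A x, x⟫_ℂ‖ ≤
      ‖cfc (fun t : ℝ => f t ^ p) (oabs P) + cfc (fun t : ℝ => f t ^ p) (oabs Q)‖ ^ (1 / p) *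
        ‖cfc (fun t : ℝ => g t ^ q) (oabs P) +
          cfc (fun t : ℝ => g t ^ q) (oabs Q)‖ ^ (1 / q) := by
  have hp2 : p = 2 := by
    have hp0 : 0 < p := by linarith
    have hq0 : 0 < q := by linarith
    have e : p * q = p + q := by field_simp at hpq; linarith
    nlinarith
  have hq2 : q = 2 := by
    subst hp2
    have hq0 : 0 < q := by linarith
    field_simp at hpq
    linarith
  subst hp2 hq2
  rw [← Real.sqrt_eq_rpow, ← Real.sqrt_eq_rpow]
  have hF := norm_sq_le_norm_cfc P Q f hf x hx
  have hG := norm_sq_le_norm_cfc P Q g hg x hx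
  have hP' := inner_le_oabs P hP f g hf hg hfg x
  have hQ' := inner_le_oabs Q hQ f g hf hg hfg x
  have h1 : ‖⟪A x, x⟫_ℂ‖ ≤ ‖⟪P x, x⟫_ℂ‖ + ‖⟪Q x, x⟫_ℂ‖ := by
    rw [hA, ContinuousLinearMap.add_apply, inner_add_left]
    refine (norm_add_le _ _).trans ?_
    rw [ContinuousLinearMap.smul_apply, inner_smul_left]
    simp
  refine h1.trans ((add_le_add hP' hQ').trans ?_)
  rw [← Real.sqrt_mul (norm_nonneg _)]
  apply Real.le_sqrt_of_sq_le
  refine le_trans ?_ (mul_le_mul hF hG (by positivity) (norm_nonneg _))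
  nlinarith [sq_nonneg (‖cfc f (oabs P) x‖ * ‖cfc g (oabs Q) x‖ -
    ‖cfc f (oabs Q) x‖ * ‖cfc g (oabs P) x‖)]
end
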